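/- Let K be a field of characteristic 0 and let A be a formal differential graded algebra over K. Then every defined Massey n-product on H(A) (for every n ≥ 3) vanishes, i.e. contains the zero class. -/

import Mathlib

/-! # Background definitions: graded vector spaces, `A∞`-algebras, dg-algebras,
Massey products, formality (following the conventions of the paper). -/

open scoped DirectSum

/-- A `ℤ`-graded vector space over `K`: a vector space together with a family of
subspaces indexed by `ℤ` into which it decomposes as a direct sum. -/
structure GVS (K : Type) [Field K] where
  carrier : Type
  [acg : AddCommGroup carrier]
  [mod : Module K carrier]
  grading : ℤ → Submodule K carrier
  decomp : DirectSum.Decomposition grading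

attribute [instance] GVS.acg GVS.mod

/-- A family of candidate `A∞`-operations on a graded vector space `V`:
`K`-multilinear maps `op n : V^{⊗ n} → V` of degree `2 - n`. -/
structure AInftyStr (K : Type) [Field K] (V : GVS K) where
  op : (n : ℕ) → MultilinearMap K (fun _ : Fin n => V.carrier) V.carrier
  op_degree : ∀ (n : ℕ) (e : Fin n → ℤ) (a : Fin n → V.carrier),
    (∀ i, a i ∈ V.grading (e i)) →
    op n a ∈ V.grading ((∑ i, e i) + (2 - (n : ℤ)))

namespace AInftyStr

variable {K : Type} [Field K] {V : GVS K}

/-- The unary operation `m₁`, the candidate differential. -/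
def d (m : AInftyStr K V) (x : V.carrier) : V.carrier :=
  m.op 1 (fun _ => x)

/-- The `n`-th Stasheff identity
`∑_{r+s+t=n} (-1)^{r+st} m_{r+1+t} (Id^{⊗r} ⊗ m_s ⊗ Id^{⊗t}) = 0`,
written out elementwise on homogeneous elements (the Koszul sign
`(-1)^{(2-s)(|a₁|+⋯+|a_r|)} = (-1)^{s(|a₁|+⋯+|a_r|)}` appears when evaluating
`Id^{⊗r} ⊗ m_s ⊗ Id^{⊗t}` on elements). -/
def Stasheff (m : AInftyStr K V) (n : ℕ) : Prop :=
  ∀ (e : ℕ → ℤ) (a : ℕ → V.carrier), (∀ i, a i ∈ V.grading (e i)) →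
    ∑ r ∈ Finset.range n, ∑ s ∈ Finset.Icc 1 (n - r),
      ((-1 : K) ^ ((r : ℤ) + (s : ℤ) * ((n : ℤ) - (r : ℤ) - (s : ℤ))
          + (s : ℤ) * ∑ i ∈ Finset.range r, e i)) •
        m.op (r + 1 + (n - r - s)) (fun j : Fin (r + 1 + (n - r - s)) =>
          if (j : ℕ) < r then a j
          else if (j : ℕ) = r then m.op s (fun i : Fin s => a (r + (i : ℕ)))
          else a ((j : ℕ) + s - 1)) = 0

end AInftyStr

/-- An `A∞`-algebra over `K`: a graded vector space with multilinear operations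
of degree `2 - n` satisfying all Stasheff identities. -/
structure AInftyAlg (K : Type) [Field K] where
  V : GVS K
  str : AInftyStr K V
  stasheff : ∀ n, 1 ≤ n → str.Stasheff n

/-- The data of an `A∞`-morphism between graded vector spaces equipped with
operations: multilinear maps `f n : V^{⊗n} → W` of degree `1 - n`. -/
structure AInftyHomData (K : Type) [Field K] (V W : GVS K) where
  f : (n : ℕ) → MultilinearMap K (fun _ : Fin n => V.carrier) W.carrier
  f_degree : ∀ (n : ℕ) (e : Fin n → ℤ) (a : Fin n → V.carrier),
    (∀ i, a i ∈ V.grading (e i)) →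
    f n a ∈ W.grading ((∑ i, e i) + (1 - (n : ℤ)))

namespace AInftyHomData

variable {K : Type} [Field K] {V W : GVS K}

/-- The linear component `f₁` of an `A∞`-morphism. -/
def f1 (φ : AInftyHomData K V W) (x : V.carrier) : W.carrier :=
  φ.f 1 (fun _ => x)

/-- The `n`-th `A∞`-morphism equation
`∑_{r+s+t=n} (-1)^{r+st} f_{r+1+t}(id^{⊗r} ⊗ m_s ⊗ id^{⊗t})
  = ∑_k ∑_{i₁+⋯+i_k=n} (-1)^{u_k} m_k (f_{i₁} ⊗ ⋯ ⊗ f_{i_k})`,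
with `u_k = ∑_{t=1}^{k-1} t (i_{k-t} - 1)`, written out elementwise on
homogeneous elements (including the Koszul signs coming from evaluating tensor
products of graded maps on elements). -/
def Eqn (φ : AInftyHomData K V W) (mV : AInftyStr K V) (mW : AInftyStr K W)
    (n : ℕ) : Prop :=
  ∀ (e : ℕ → ℤ) (a : ℕ → V.carrier), (∀ i, a i ∈ V.grading (e i)) →
    (∑ r ∈ Finset.range n, ∑ s ∈ Finset.Icc 1 (n - r),
      ((-1 : K) ^ ((r : ℤ) + (s : ℤ) * ((n : ℤ) - (r : ℤ) - (s : ℤ))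
          + (s : ℤ) * ∑ i ∈ Finset.range r, e i)) •
        φ.f (r + 1 + (n - r - s)) (fun j : Fin (r + 1 + (n - r - s)) =>
          if (j : ℕ) < r then a j
          else if (j : ℕ) = r then mV.op s (fun i : Fin s => a (r + (i : ℕ)))
          else a ((j : ℕ) + s - 1)))
    =
    ∑ c : Composition n,
      ((-1 : K) ^ ((∑ j : Fin c.length,
            ((c.length : ℤ) - 1 - (j : ℤ)) * ((c.blocksFun j : ℤ) - 1))
          + ∑ j : Fin c.length,
            (1 - (c.blocksFun j : ℤ)) * ∑ i ∈ Finset.range (c.sizeUpTo (j : ℕ)), e i)) •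
        mW.op c.length (fun j : Fin c.length =>
          φ.f (c.blocksFun j) (fun i : Fin (c.blocksFun j) =>
            a (c.sizeUpTo (j : ℕ) + (i : ℕ))))

/-- `φ` is a quasi-isomorphism: its linear part `f₁` induces an isomorphism on
cohomology (injectivity and surjectivity of the induced map, spelled out). -/
def IsQuasiIso (φ : AInftyHomData K V W) (mV : AInftyStr K V) (mW : AInftyStr K W) : Prop :=
  (∀ x, mV.d x = 0 → (∃ c, φ.f1 x = mW.d c) → ∃ c, x = mV.d c) ∧
  (∀ y, mW.d y = 0 → ∃ x, mV.d x = 0 ∧ ∃ c, y - φ.f1 x = mW.d c)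

end AInftyHomData

/-- `φ` is an `A∞`-morphism from `(V, mV)` to `(W, mW)`: all morphism equations hold. -/
def IsAInftyMorphism {K : Type} [Field K] {V W : GVS K} (φ : AInftyHomData K V W)
    (mV : AInftyStr K V) (mW : AInftyStr K W) : Prop :=
  ∀ n, 1 ≤ n → φ.Eqn mV mW n

/-- A dg-algebra: an `A∞`-algebra whose operations of arity `≥ 3` vanish. -/
structure DGAlg (K : Type) [Field K] where
  V : GVS K
  str : AInftyStr K V
  stasheff : ∀ n, 1 ≤ n → str.Stasheff n
  higher : ∀ n, 3 ≤ n → str.op n = 0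

namespace DGAlg

variable {K : Type} [Field K]

/-- The differential of a dg-algebra. -/
def d (A : DGAlg K) (x : A.V.carrier) : A.V.carrier := A.str.d x

/-- The product of a dg-algebra. -/
def mul (A : DGAlg K) (x y : A.V.carrier) : A.V.carrier := A.str.op 2 ![x, y]

/-- A dg-algebra is formal if it is `A∞`-quasi-isomorphic to a dg-algebra with
trivial differential. -/
def IsFormal (A : DGAlg K) : Prop :=
  ∃ B : DGAlg K, (∀ x, B.d x = 0) ∧
    ∃ φ : AInftyHomData K B.V A.V, IsAInftyMorphism φ B.str A.str ∧
      φ.IsQuasiIso B.str A.str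

end DGAlg

/-! ## Massey products -/

/-- The degree of the cochain `a i j` in a defining system for classes of degrees
`dg 0, …, dg (n-1)` (0-indexed): `|a_{i,j}| = (∑_{k=i}^{j-1} |x_k|) - (j - i - 1)`. -/
def mDeg (dg : ℕ → ℤ) (i j : ℕ) : ℤ :=
  (∑ k ∈ Finset.Ico i j, dg k) - ((j : ℤ) - (i : ℤ) - 1)

/-- A defining system for the (classes of the) cocycles `u 0, …, u (n-1)`, of
degrees `dg 0, …, dg (n-1)`: cochains `a i j` for `0 ≤ i < j ≤ n`, `(i,j) ≠ (0,n)`,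
with `a i (i+1)` representing the class of `u i`, and
`d (a i j) = ∑_{i<k<j} (-1)^{|a i k|} (a i k) * (a k j)`. -/
structure DefiningSystem {K : Type} [Field K] (A : DGAlg K) (n : ℕ)
    (dg : ℕ → ℤ) (u : ℕ → A.V.carrier) where
  a : ℕ → ℕ → A.V.carrier
  mem_grading : ∀ i j, i < j → j ≤ n → (i, j) ≠ (0, n) →
    a i j ∈ A.V.grading (mDeg dg i j)
  represents : ∀ i, i < n → ∃ c, a i (i + 1) - u i = A.d c
  d_eq : ∀ i j, i < j → j ≤ n → (i, j) ≠ (0, n) →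
    A.d (a i j) = ∑ k ∈ Finset.Ioo i j,
      A.mul (((-1 : K) ^ mDeg dg i k) • a i k) (a k j)

/-- The cocycle `∑_{0<k<n} (-1)^{|a 0 k|} (a 0 k) * (a k n)` produced by a
defining system; its class is the corresponding element of the Massey product. -/
def DefiningSystem.value {K : Type} [Field K] {A : DGAlg K} {n : ℕ}
    {dg : ℕ → ℤ} {u : ℕ → A.V.carrier} (ds : DefiningSystem A n dg u) :
    A.V.carrier :=
  ∑ k ∈ Finset.Ioo 0 n, A.mul (((-1 : K) ^ mDeg dg 0 k) • ds.a 0 k) (ds.a k n)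

/-- `u 0, …, u (n-1)` are valid representatives of cohomology classes of degrees
`dg 0, …, dg (n-1)`: homogeneous cocycles. -/
def ValidReps {K : Type} [Field K] (A : DGAlg K) (n : ℕ) (dg : ℕ → ℤ)
    (u : ℕ → A.V.carrier) : Prop :=
  ∀ i, i < n → A.d (u i) = 0 ∧ u i ∈ A.V.grading (dg i)

/-- The Massey `n`-product of the classes of `u 0, …, u (n-1)` is defined, i.e.
some defining system exists. -/
def MasseyDefined {K : Type} [Field K] (A : DGAlg K) (n : ℕ) (dg : ℕ → ℤ)
    (u : ℕ → A.V.carrier) : Prop :=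
  Nonempty (DefiningSystem A n dg u)

/-- The Massey `n`-product of the classes of `u 0, …, u (n-1)` contains the class
of the cocycle `x`. -/
def MasseyContains {K : Type} [Field K] (A : DGAlg K) (n : ℕ) (dg : ℕ → ℤ)
    (u : ℕ → A.V.carrier) (x : A.V.carrier) : Prop :=
  ∃ ds : DefiningSystem A n dg u, ∃ c, ds.value - x = A.d c

/-- The Massey `n`-product of the classes of `u 0, …, u (n-1)` vanishes, i.e.
contains the zero class. -/
def MasseyVanishes {K : Type} [Field K] (A : DGAlg K) (n : ℕ) (dg : ℕ → ℤ)
    (u : ℕ → A.V.carrier) : Prop :=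
  MasseyContains A n dg u 0

/-! ## Graded linear maps -/

section Helpers

variable {K : Type} [Field K]

/-- The projection of a graded vector space onto its component of degree `p`. -/
noncomputable def GVS.proj (V : GVS K) (p : ℤ) : V.carrier →ₗ[K] V.carrier :=
  letI := V.decomp
  (V.grading p).subtype ∘ₗ DirectSum.component K ℤ (fun i => V.grading i) p ∘ₗ
    (DirectSum.decomposeLinearEquiv V.grading).toLinearMap

theorem GVS.proj_mem (V : GVS K) (p : ℤ) (x : V.carrier) : V.proj p x ∈ V.grading p :=
  Submodule.coe_mem _

theorem GVS.proj_of_mem (V : GVS K) {p : ℤ} {x : V.carrier} (hx : x ∈ V.grading p) :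
    V.proj p x = x :=
  letI := V.decomp
  DirectSum.decompose_of_mem_same V.grading hx

theorem GVS.proj_of_mem_ne (V : GVS K) {p q : ℤ} {x : V.carrier} (hx : x ∈ V.grading p)
    (h : p ≠ q) : V.proj q x = 0 :=
  letI := V.decomp
  DirectSum.decompose_of_mem_ne V.grading hx h

/-- Homogeneous linear maps commute with the projections onto homogeneous components. -/
theorem GVS.proj_map {V W : GVS K} (F : V.carrier →ₗ[K] W.carrier) (s : ℤ)
    (hF : ∀ p x, x ∈ V.grading p → F x ∈ W.grading (p + s)) (p : ℤ) (x : V.carrier) :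
    W.proj (p + s) (F x) = F (V.proj p x) := by
  let := V.decomp
  induction x using DirectSum.Decomposition.inductionOn V.grading with
  | zero => simp
  | @homogeneous i m =>
    by_cases h : i = p
    · subst h
      rw [V.proj_of_mem m.2, W.proj_of_mem (hF _ _ m.2)]
    · rw [V.proj_of_mem_ne m.2 h, W.proj_of_mem_ne (hF _ _ m.2) (by omega), map_zero]
  | add m m' h h' => simp only [map_add, h, h']

/-- A unary multilinear map, as a linear map. -/
def MultilinearMap.unary {M N : Type} [AddCommGroup M] [AddCommGroup N] [Module K M]
    [Module K N] (g : MultilinearMap K (fun _ : Fin 1 => M) N) : M →ₗ[K] N :=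
  g.toLinearMap 0 0

theorem MultilinearMap.unary_apply {M N : Type} [AddCommGroup M] [AddCommGroup N] [Module K M]
    [Module K N] (g : MultilinearMap K (fun _ : Fin 1 => M) N) (x : M) :
    g.unary x = g (fun _ => x) := by
  simp only [MultilinearMap.unary, MultilinearMap.toLinearMap_apply]
  congr 1
  funext i
  rw [Subsingleton.elim i 0, Function.update_self]

/-! ## Linearity, degrees and the Leibniz rule in a dg-algebra -/

namespace DGAlg

/-- The differential as a linear map. -/
def dHom (A : DGAlg K) : A.V.carrier →ₗ[K] A.V.carrier := (A.str.op 1).unary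

theorem dHom_apply (A : DGAlg K) (x : A.V.carrier) : A.dHom x = A.d x :=
  MultilinearMap.unary_apply _ x

theorem d_mem (A : DGAlg K) (p : ℤ) (x : A.V.carrier) (hx : x ∈ A.V.grading p) :
    A.dHom x ∈ A.V.grading (p + 1) := by
  have h := A.str.op_degree 1 (fun _ => p) (fun _ => x) (fun _ => hx)
  rw [dHom_apply]
  simpa [d, AInftyStr.d] using h

/-- The product as a bilinear map. -/
def mulHom (A : DGAlg K) : A.V.carrier →ₗ[K] A.V.carrier →ₗ[K] A.V.carrier :=
  have h₀ (x y z : A.V.carrier) : Function.update ![x, y] 0 z = ![z, y] := by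
    funext i; fin_cases i <;> rfl
  have h₁ (x y z : A.V.carrier) : Function.update ![x, y] 1 z = ![x, z] := by
    funext i; fin_cases i <;> rfl
  LinearMap.mk₂ K A.mul
    (fun x x' y => by simpa only [h₀, mul] using (A.str.op 2).map_update_add ![x, y] 0 x x')
    (fun c x y => by simpa only [h₀, mul] using (A.str.op 2).map_update_smul ![x, y] 0 c x)
    (fun x y y' => by simpa only [h₁, mul] using (A.str.op 2).map_update_add ![x, y] 1 y y')
    (fun c x y => by simpa only [h₁, mul] using (A.str.op 2).map_update_smul ![x, y] 1 c y)

theorem mulHom_apply (A : DGAlg K) (x y : A.V.carrier) : A.mulHom x y = A.mul x y := rfl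

theorem leibniz (A : DGAlg K) {p q : ℤ} {x y : A.V.carrier} (hx : x ∈ A.V.grading p)
    (hy : y ∈ A.V.grading q) :
    A.dHom (A.mulHom x y) = A.mulHom (A.dHom x) y + (-1 : K) ^ p • A.mulHom x (A.dHom y) := by
  have h := A.stasheff 2 (by norm_num) (fun i => if i = 0 then p else q)
    (fun i => if i = 0 then x else y) (by intro i; split_ifs <;> assumption)
  have e1 : Finset.Icc 1 (2 - 0) = {1, 2} := by decide
  have e2 : Finset.Icc 1 (2 - 1) = {1} := by decide
  rw [Finset.sum_range_succ, Finset.sum_range_one, e1, e2, Finset.sum_singleton,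
    Finset.sum_pair (by norm_num)] at h
  have t1 : A.mulHom (A.dHom x) y = A.str.op (0 + 1 + (2 - 0 - 1))
      (fun j : Fin (0 + 1 + (2 - 0 - 1)) =>
          if (j : ℕ) < 0 then (if (j : ℕ) = 0 then x else y)
          else if (j : ℕ) = 0 then A.str.op 1
            (fun i : Fin 1 => if (0 + (i : ℕ)) = 0 then x else y)
          else (if ((j : ℕ) + 1 - 1) = 0 then x else y)) := by
    rw [mulHom_apply, dHom_apply]
    change A.str.op 2 _ = A.str.op 2 _
    congr 1
    funext j
    fin_cases j
    · simp [d, AInftyStr.d]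
    · simp
  have t2 : A.dHom (A.mulHom x y) = A.str.op (0 + 1 + (2 - 0 - 2))
      (fun j : Fin (0 + 1 + (2 - 0 - 2)) =>
          if (j : ℕ) < 0 then (if (j : ℕ) = 0 then x else y)
          else if (j : ℕ) = 0 then A.str.op 2
            (fun i : Fin 2 => if (0 + (i : ℕ)) = 0 then x else y)
          else (if ((j : ℕ) + 2 - 1) = 0 then x else y)) := by
    rw [mulHom_apply, dHom_apply]
    change A.str.op 1 _ = A.str.op 1 _
    congr 1
    funext j
    fin_cases j
    simp only [mul, lt_irrefl, if_false, if_true]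
    congr 1
    funext i
    fin_cases i <;> simp
  have t3 : A.mulHom x (A.dHom y) = A.str.op (1 + 1 + (2 - 1 - 1))
      (fun j : Fin (1 + 1 + (2 - 1 - 1)) =>
          if (j : ℕ) < 1 then (if (j : ℕ) = 0 then x else y)
          else if (j : ℕ) = 1 then A.str.op 1
            (fun i : Fin 1 => if (1 + (i : ℕ)) = 0 then x else y)
          else (if ((j : ℕ) + 1 - 1) = 0 then x else y)) := by
    rw [mulHom_apply, dHom_apply]
    change A.str.op 2 _ = A.str.op 2 _
    congr 1
    funext j
    fin_cases j
    · simp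
    · simp [d, AInftyStr.d]
  rw [← t1, ← t2, ← t3] at h
  norm_num at h
  have hs : (-1 : K) ^ (1 + p) = -(-1 : K) ^ p := by
    rw [zpow_add₀ (by norm_num)]; simp
  rw [hs, neg_smul] at h
  rw [← sub_eq_zero, ← h]
  abel

/-- If cohomologous homogeneous cocycles have exact products on one side, they do on the other. -/
theorem mul_exact_of_cohomologous (A : DGAlg K) {p q p' q' : ℤ}
    {x y x' y' c e : A.V.carrier} (hx : x ∈ A.V.grading p)
    (hy' : y' ∈ A.V.grading q) (hc : c ∈ A.V.grading p') (he : e ∈ A.V.grading q')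
    (dx : A.dHom x = 0) (dy' : A.dHom y' = 0)
    (hxc : x' - x = A.dHom c) (hye : y' - y = A.dHom e)
    (h : A.mulHom x' y' ∈ LinearMap.range A.dHom) :
    A.mulHom x y ∈ LinearMap.range A.dHom := by
  have h1 : A.mulHom (A.dHom c) y' ∈ LinearMap.range A.dHom :=
    ⟨A.mulHom c y', by rw [A.leibniz hc hy', dy']; simp⟩
  have h2 : (-1 : K) ^ p • A.mulHom x (A.dHom e) ∈ LinearMap.range A.dHom :=
    ⟨A.mulHom x e, by rw [A.leibniz hx he, dx]; simp⟩
  rw [Submodule.smul_mem_iff _ (zpow_ne_zero _ (by norm_num))] at h2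
  have : A.mulHom x y = A.mulHom x' y' - A.mulHom (A.dHom c) y' - A.mulHom x (A.dHom e) := by
    rw [← hxc, ← hye]
    simp only [map_sub, LinearMap.sub_apply]
    abel
  rw [this]
  exact sub_mem (sub_mem h h1) h2

end DGAlg

/-! ## Compositions with at most two blocks -/

/-- The composition `n = k + (n - k)` (with a junk value unless `0 < k < n`). -/
def Composition.pair (n k : ℕ) : Composition n :=
  if h : 0 < k ∧ k < n then
    ⟨[k, n - k], by intro i hi; simp at hi; omega, by simp; omega⟩
  else Composition.ones n

theorem Composition.pair_blocks {n k : ℕ} (h : 0 < k ∧ k < n) :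
    (Composition.pair n k).blocks = [k, n - k] := by
  rw [Composition.pair, dif_pos h]

theorem Composition.sum_eq_single_add_pair {M : Type} [AddCommMonoid M] {n : ℕ} (hn : 0 < n)
    (g : Composition n → M) (hg : ∀ c : Composition n, 3 ≤ c.length → g c = 0) :
    ∑ c, g c = g (Composition.single n hn) +
      ∑ k ∈ Finset.Ioo 0 n, g (Composition.pair n k) := by
  classical
  have hinj : Set.InjOn (Composition.pair n) (Finset.Ioo 0 n : Finset ℕ) := by
    intro k hk l hl h
    simp only [Finset.coe_Ioo, Set.mem_Ioo] at hk hl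
    have := congrArg Composition.blocks h
    rw [Composition.pair_blocks hk, Composition.pair_blocks hl] at this
    simpa using (List.cons.inj this).1
  have hnot : Composition.single n hn ∉ (Finset.Ioo 0 n).image (Composition.pair n) := by
    intro h
    obtain ⟨k, hk, h⟩ := Finset.mem_image.1 h
    rw [Finset.mem_Ioo] at hk
    have := congrArg Composition.blocks h
    rw [Composition.pair_blocks hk, Composition.single_blocks] at this
    simp at this
  rw [← Finset.sum_image hinj, ← Finset.sum_insert hnot]
  symm
  apply Finset.sum_subset (Finset.subset_univ _)
  intro c _ hc
  apply hg
  by_contra hlt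
  apply hc
  have hlen : c.blocks.length < 3 := by rw [c.blocks_length]; omega
  have hs := c.blocks_sum
  have hp : ∀ i ∈ c.blocks, 0 < i := fun i hi => c.blocks_pos hi
  rw [Finset.mem_insert, Finset.mem_image]
  match hb : c.blocks with
  | [] => rw [hb] at hs; simp at hs; omega
  | [k] =>
    left
    rw [hb] at hs
    apply Composition.ext
    rw [Composition.single_blocks, hb]
    simpa using hs
  | [k, l] =>
    right
    rw [hb] at hs hp
    simp at hs hp
    refine ⟨k, by rw [Finset.mem_Ioo]; omega, ?_⟩
    apply Composition.ext
    rw [Composition.pair_blocks (by omega), hb]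
    simp; omega
  | _ :: _ :: _ :: _ => rw [hb] at hlen; simp at hlen; omega

/-! ## `A∞`-morphisms into a dg-algebra -/

namespace AInftyHomData

/-- The value of the component `f m` on the first `m` entries of a sequence. -/
def eval {V W : GVS K} (φ : AInftyHomData K V W) (m : ℕ) (a : ℕ → V.carrier) : W.carrier :=
  φ.f m (fun i => a i)

theorem eval_one {V W : GVS K} (φ : AInftyHomData K V W) (a : ℕ → V.carrier) :
    φ.eval 1 a = φ.f1 (a 0) := by
  rw [eval, f1]
  congr 1
  funext i
  rw [Subsingleton.elim i 0, Fin.val_zero]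

theorem f1_mem {V W : GVS K} (φ : AInftyHomData K V W) (p : ℤ) (x : V.carrier)
    (hx : x ∈ V.grading p) : (φ.f 1).unary x ∈ W.grading (p + 0) := by
  have h := φ.f_degree 1 (fun _ => p) (fun _ => x) (fun _ => hx)
  rw [MultilinearMap.unary_apply]
  simpa using h

/-- When the target is a dg-algebra, only compositions with at most two blocks contribute to
the right-hand side of the morphism equations. -/
theorem sum_composition_eq {V : GVS K} {A : DGAlg K} (φ : AInftyHomData K V A.V) {n : ℕ}
    (hn : 0 < n) (e : ℕ → ℤ) (a : ℕ → V.carrier) :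
    ∑ c : Composition n,
      ((-1 : K) ^ ((∑ j : Fin c.length,
            ((c.length : ℤ) - 1 - (j : ℤ)) * ((c.blocksFun j : ℤ) - 1))
          + ∑ j : Fin c.length,
            (1 - (c.blocksFun j : ℤ)) * ∑ i ∈ Finset.range (c.sizeUpTo (j : ℕ)), e i)) •
        A.str.op c.length (fun j : Fin c.length =>
          φ.f (c.blocksFun j) (fun i : Fin (c.blocksFun j) =>
            a (c.sizeUpTo (j : ℕ) + (i : ℕ))))
    = A.dHom (φ.eval n a) + ∑ k ∈ Finset.Ioo 0 n,
      (-1 : K) ^ (((k : ℤ) - 1) + (1 - ((n : ℤ) - k)) * ∑ i ∈ Finset.range k, e i) •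
        A.mulHom (φ.eval k a) (φ.eval (n - k) (fun i => a (k + i))) := by
  rw [Composition.sum_eq_single_add_pair hn]
  · congr 1
    · generalize hc : Composition.single n hn = c
      have hb : c.blocks = [n] := by rw [← hc, Composition.single_blocks]
      clear hc
      obtain ⟨b, hpos, hsum⟩ := c
      subst hb
      have hz : ∀ z : K, z = 1 → ∀ v w : A.V.carrier, v = w → z • v = w := by
        rintro z rfl v w rfl; simp
      apply hz
      · change (-1 : K) ^ ((∑ j : Fin 1, _) + ∑ j : Fin 1, _) = 1
        rw [Fin.sum_univ_one, Fin.sum_univ_one]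
        simp [Composition.sizeUpTo, Composition.length]
      · rw [DGAlg.dHom_apply]
        change A.str.op 1 _ = A.str.op 1 _
        congr 1
        funext j
        rw [Subsingleton.elim (α := Fin 1) j 0]
        change φ.f n _ = φ.f n _
        congr 1
        funext i
        simp [Composition.sizeUpTo]
    · apply Finset.sum_congr rfl
      intro k hk
      rw [Finset.mem_Ioo] at hk
      generalize hc : Composition.pair n k = c
      have hb : c.blocks = [k, n - k] := by rw [← hc, Composition.pair_blocks hk]
      clear hc
      obtain ⟨b, hpos, hsum⟩ := c
      subst hb
      have hkn : ((n - k : ℕ) : ℤ) = (n : ℤ) - k := by omega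
      congr 1
      · congr 1
        change ((∑ j : Fin 2, _) + ∑ j : Fin 2, _) = _
        rw [Fin.sum_univ_two, Fin.sum_univ_two]
        simp [Composition.sizeUpTo, Composition.length, Composition.blocksFun, hkn]
      · rw [DGAlg.mulHom_apply]
        change A.str.op 2 _ = A.str.op 2 _
        congr 1
        funext j
        fin_cases j
        · change φ.f k _ = φ.f k _
          congr 1
          funext i
          simp [Composition.sizeUpTo]
        · change φ.f (n - k) _ = φ.f (n - k) _
          congr 1
  · intro c hc
    rw [A.higher _ hc]
    simp

section Morphism

variable {A B : DGAlg K} {φ : AInftyHomData K B.V A.V}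

theorem map_mul_of_d_eq_zero (hB : ∀ x, B.d x = 0)
    (hφ : IsAInftyMorphism φ B.str A.str) (e : ℕ → ℤ) (a : ℕ → B.V.carrier)
    (ha : ∀ i, a i ∈ B.V.grading (e i)) :
    ∃ c, φ.f1 (B.mul (a 0) (a 1)) = A.dHom c + A.mulHom (φ.f1 (a 0)) (φ.f1 (a 1)) := by
  have h := hφ 2 (by norm_num) e a ha
  rw [φ.sum_composition_eq (by norm_num)] at h
  have e1 : Finset.Icc 1 (2 - 0) = {1, 2} := by decide
  have e2 : Finset.Icc 1 (2 - 1) = {1} := by decide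
  have e3 : Finset.Ioo 0 2 = {1} := by decide
  have unary_eq_zero (r n : ℕ) : φ.f (r + 1 + (n - r - 1))
      (fun j : Fin (r + 1 + (n - r - 1)) =>
          if (j : ℕ) < r then a j
          else if (j : ℕ) = r then B.str.op 1 (fun i : Fin 1 => a (r + (i : ℕ)))
          else a ((j : ℕ) + 1 - 1)) = 0 := by
    apply MultilinearMap.map_coord_zero _ (⟨r, by omega⟩ : Fin (r + 1 + (n - r - 1)))
    simp only [lt_irrefl, if_false, if_true]
    rw [← hB (a r)]
    simp [DGAlg.d, AInftyStr.d]
  have binary_eq : φ.f (0 + 1 + (2 - 0 - 2)) (fun j : Fin (0 + 1 + (2 - 0 - 2)) =>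
          if (j : ℕ) < 0 then a j
          else if (j : ℕ) = 0 then B.str.op 2 (fun i : Fin 2 => a (0 + (i : ℕ)))
          else a ((j : ℕ) + 2 - 1)) = φ.f1 (B.mul (a 0) (a 1)) := by
    change φ.f 1 _ = φ.f 1 _
    congr 1
    funext j
    fin_cases j
    simp only [DGAlg.mul, lt_irrefl, if_false, if_true]
    congr 1
    funext i
    fin_cases i <;> simp
  rw [Finset.sum_range_succ, Finset.sum_range_one, e1, e2, e3, Finset.sum_singleton,
    Finset.sum_singleton, Finset.sum_pair (by norm_num), unary_eq_zero 0 2, unary_eq_zero 1 2,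
    binary_eq] at h
  refine ⟨φ.eval 2 a, ?_⟩
  norm_num [eval_one] at h
  exact h

theorem d_eval_of_mul_eq_zero (hB : ∀ x, B.d x = 0)
    (hφ : IsAInftyMorphism φ B.str A.str) (e : ℕ → ℤ) (a : ℕ → B.V.carrier)
    (ha : ∀ i, a i ∈ B.V.grading (e i)) {n : ℕ} (hn : 0 < n)
    (hmul : ∀ i, i + 1 < n → B.mul (a i) (a (i + 1)) = 0) :
    A.dHom (φ.eval n a) + ∑ k ∈ Finset.Ioo 0 n,
      (-1 : K) ^ (((k : ℤ) - 1) + (1 - ((n : ℤ) - k)) * ∑ i ∈ Finset.range k, e i) •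
        A.mulHom (φ.eval k a) (φ.eval (n - k) (fun i => a (k + i))) = 0 := by
  rw [← φ.sum_composition_eq hn, ← hφ n hn e a ha]
  apply Finset.sum_eq_zero
  intro r hr
  apply Finset.sum_eq_zero
  intro s hs
  rw [Finset.mem_range] at hr
  rw [Finset.mem_Icc] at hs
  rw [MultilinearMap.map_coord_zero _ (⟨r, by omega⟩ : Fin (r + 1 + (n - r - s))), smul_zero]
  simp only [lt_irrefl, if_false, if_true]
  obtain rfl | rfl | h3 : s = 1 ∨ s = 2 ∨ 3 ≤ s := by omega
  · rw [← hB (a r)]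
    simp [DGAlg.d, AInftyStr.d]
  · rw [← hmul r (by omega), DGAlg.mul]
    congr 1
    funext i
    fin_cases i <;> simp
  · rw [B.higher s h3]
    simp

/-- Homogeneous classes lift along a quasi-isomorphism to homogeneous elements. -/
theorem IsQuasiIso.exists_homogeneous_lift (hq : φ.IsQuasiIso B.str A.str) {p : ℤ}
    {u : A.V.carrier} (hu : u ∈ A.V.grading p) (du : A.dHom u = 0) :
    ∃ x ∈ B.V.grading p, ∃ c ∈ A.V.grading (p - 1), u - φ.f1 x = A.dHom c := by
  rw [DGAlg.dHom_apply] at du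
  obtain ⟨x, -, c, hc⟩ := hq.2 u du
  refine ⟨B.V.proj p x, B.V.proj_mem _ _, A.V.proj (p - 1) c, A.V.proj_mem _ _, ?_⟩
  have h1 := GVS.proj_map (φ.f 1).unary 0 φ.f1_mem p x
  have h2 := GVS.proj_map A.dHom 1 A.d_mem (p - 1) c
  rw [add_zero, MultilinearMap.unary_apply, MultilinearMap.unary_apply] at h1
  rw [sub_add_cancel, DGAlg.dHom_apply] at h2
  have h3 := congrArg (A.V.proj p) hc
  rw [map_sub, A.V.proj_of_mem hu] at h3
  exact (congrArg (u - ·) h1.symm).trans (h3.trans h2)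

theorem d_f1_of_d_eq_zero (hB : ∀ x, B.d x = 0) (hφ : IsAInftyMorphism φ B.str A.str)
    {p : ℤ} {x : B.V.carrier} (hx : x ∈ B.V.grading p) : A.dHom (φ.f1 x) = 0 := by
  have h := d_eval_of_mul_eq_zero hB hφ (fun _ => p) (fun _ => x) (fun _ => hx)
    (n := 1) one_pos (by intro i hi; omega)
  have he : Finset.Ioo 0 1 = (∅ : Finset ℕ) := by decide
  rw [eval_one, he, Finset.sum_empty, add_zero] at h
  exact h

end Morphism

end AInftyHomData

/-! ## The defining system pushed forward from the formal model -/

/-- Exponent of the sign with which `f_{j-i}(x_i, …, x_{j-1})` enters the defining system. -/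
def masseySign (dg : ℕ → ℤ) (i j : ℕ) : ℤ :=
  1 + ((j : ℤ) - i) + ∑ l ∈ Finset.Ico i j, ((j : ℤ) - l - 1) * dg l

theorem masseySign_add (dg : ℕ → ℤ) {i k j : ℕ} (hik : i ≤ k) (hkj : k ≤ j) :
    masseySign dg i k + masseySign dg k j + ((j : ℤ) - k) * ∑ l ∈ Finset.Ico i k, dg l =
      masseySign dg i j + 1 := by
  rw [masseySign, masseySign, masseySign, ← Finset.sum_Ico_consecutive _ hik hkj, Finset.mul_sum]
  have : ∑ l ∈ Finset.Ico i k, ((j : ℤ) - l - 1) * dg l =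
      ∑ l ∈ Finset.Ico i k, ((k : ℤ) - l - 1) * dg l +
        ∑ l ∈ Finset.Ico i k, ((j : ℤ) - k) * dg l := by
    rw [← Finset.sum_add_distrib]
    exact Finset.sum_congr rfl fun l _ => by ring
  rw [this]
  ring

theorem masseySign_succ (dg : ℕ → ℤ) (i : ℕ) : masseySign dg i (i + 1) = 2 := by
  simp [masseySign]

theorem neg_one_zpow_eq_of_even_sub {p q : ℤ} (h : Even (p - q)) : (-1 : K) ^ p = (-1 : K) ^ q := by
  rw [← sub_add_cancel p q, zpow_add₀ (by norm_num), h.neg_one_zpow, one_mul]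

end Helpers

/-- The cochains `± f_{j-i}(x_i, …, x_{j-1})`, satisfying the equations of a defining system. -/
def AInftyHomData.masseyCochain {K : Type} [Field K] {V W : GVS K} (φ : AInftyHomData K V W)
    (dg : ℕ → ℤ) (x : ℕ → V.carrier) (i j : ℕ) : W.carrier :=
  (-1 : K) ^ masseySign dg i j • φ.eval (j - i) (fun l => x (i + l))

theorem AInftyHomData.masseyCochain_mem {K : Type} [Field K] {V W : GVS K}
    (φ : AInftyHomData K V W) {dg : ℕ → ℤ} {x : ℕ → V.carrier}
    (hx : ∀ i, x i ∈ V.grading (dg i)) {i j : ℕ} (hij : i < j) :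
    φ.masseyCochain dg x i j ∈ W.grading (mDeg dg i j) := by
  apply Submodule.smul_mem
  have h := φ.f_degree (j - i) (fun l => dg (i + l)) (fun l => x (i + l)) (fun l => hx _)
  rw [eval]
  convert h using 2
  rw [mDeg, Finset.sum_Ico_eq_sum_range, Finset.sum_range]
  push_cast [Nat.cast_sub hij.le]
  ring

theorem AInftyHomData.d_masseyCochain {K : Type} [Field K] {A B : DGAlg K}
    {φ : AInftyHomData K B.V A.V} (hB : ∀ x, B.d x = 0)
    (hφ : IsAInftyMorphism φ B.str A.str) {dg : ℕ → ℤ} {x : ℕ → B.V.carrier}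
    (hx : ∀ i, x i ∈ B.V.grading (dg i)) (hmul : ∀ i, B.mul (x i) (x (i + 1)) = 0)
    {i j : ℕ} (hij : i < j) :
    A.d (φ.masseyCochain dg x i j) = ∑ k ∈ Finset.Ioo i j,
      A.mul (((-1 : K) ^ mDeg dg i k) • φ.masseyCochain dg x i k)
        (φ.masseyCochain dg x k j) := by
  have h := d_eval_of_mul_eq_zero hB hφ (fun l => dg (i + l)) (fun l => x (i + l))
    (fun l => hx _) (n := j - i) (by omega) (fun l _ => hmul (i + l))
  have hioo : Finset.Ioo i j = (Finset.Ioo 0 (j - i)).map (addLeftEmbedding i) := by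
    rw [Finset.map_add_left_Ioo]
    congr 1; omega
  rw [← DGAlg.dHom_apply, masseyCochain, map_smul, eq_neg_of_add_eq_zero_left h, hioo,
    Finset.sum_map, ← Finset.sum_neg_distrib, Finset.smul_sum]
  apply Finset.sum_congr rfl
  intro k hk
  rw [Finset.mem_Ioo] at hk
  have e1 : i + k - i = k := by omega
  have e2 : j - (i + k) = j - i - k := by omega
  simp only [addLeftEmbedding_apply, masseyCochain, e1, e2, ← DGAlg.mulHom_apply, map_smul,
    LinearMap.smul_apply, smul_smul, ← neg_smul, add_assoc]
  congr 1
  have hs := masseySign_add dg (i := i) (k := i + k) (j := j) (by omega) (by omega)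
  have hz : (-1 : K) ≠ 0 := by norm_num
  have hneg (p : ℤ) : -(-1 : K) ^ p = (-1) ^ (p + 1) := by rw [zpow_add_one₀ hz, mul_neg_one]
  rw [hneg, ← zpow_add₀ hz, ← zpow_add₀ hz, ← zpow_add₀ hz]
  apply neg_one_zpow_eq_of_even_sub
  rw [mDeg]
  rw [Finset.sum_Ico_eq_sum_range, e1] at hs ⊢
  push_cast [Nat.cast_sub hij.le] at hs ⊢
  generalize ∑ l ∈ Finset.range k, dg (i + l) = E at hs ⊢
  exact ⟨k - 1, by linear_combination -hs⟩

/-- Every defined Massey `n`-product (`n ≥ 3`) on a formal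
dg-algebra over a field of characteristic `0` vanishes, i.e. contains the zero
class. -/
theorem massey_vanishes_of_formal
    (K : Type) [Field K] [CharZero K] (A : DGAlg K) (hA : A.IsFormal) :
    ∀ n, 3 ≤ n → ∀ (dg : ℕ → ℤ) (u : ℕ → A.V.carrier),
      ValidReps A n dg u → MasseyDefined A n dg u → MasseyVanishes A n dg u := by
  obtain ⟨B, hB, φ, hφ, hq⟩ := hA
  rintro n hn dg u hu ⟨ds⟩
  have hdeg : ∀ i, mDeg dg i (i + 1) = dg i := by intro i; simp [mDeg]
  have hne : ∀ i, (i, i + 1) ≠ (0, n) := by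
    intro i h
    rw [Prod.mk.injEq] at h
    omega
  have hmem : ∀ i < n, ds.a i (i + 1) ∈ A.V.grading (dg i) := fun i hi => by
    simpa only [hdeg] using ds.mem_grading i (i + 1) (by omega) (by omega) (hne i)
  have hcoc : ∀ i < n, A.dHom (ds.a i (i + 1)) = 0 := fun i hi => by
    rw [A.dHom_apply, ds.d_eq i (i + 1) (by omega) (by omega) (hne i)]
    apply Finset.sum_eq_zero
    intro k hk
    rw [Finset.mem_Ioo] at hk
    omega
  have hlift : ∀ i, ∃ x ∈ B.V.grading (dg i), (n ≤ i → x = 0) ∧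
      (i < n → ∃ c ∈ A.V.grading (dg i - 1), ds.a i (i + 1) - φ.f1 x = A.dHom c) := by
    intro i
    by_cases hi : i < n
    · obtain ⟨x, hx, hc⟩ := hq.exists_homogeneous_lift (hmem i hi) (hcoc i hi)
      exact ⟨x, hx, fun h => absurd h (by omega), fun _ => hc⟩
    · exact ⟨0, zero_mem _, fun _ => rfl, fun h => absurd h hi⟩
  choose x hx hx0 hxc using hlift
  have hf1 : ∀ i, φ.f1 (x i) ∈ A.V.grading (dg i) := fun i => by
    simpa only [MultilinearMap.unary_apply, add_zero, AInftyHomData.f1] using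
      φ.f1_mem _ _ (hx i)
  have hmul : ∀ i, B.mul (x i) (x (i + 1)) = 0 := by
    intro i
    by_cases hi : i + 1 < n
    · obtain ⟨c, hc, hc'⟩ := hxc i (by omega)
      obtain ⟨e, he, he'⟩ := hxc (i + 1) hi
      have hprod : A.mulHom (ds.a i (i + 1)) (ds.a (i + 1) (i + 2)) ∈
          LinearMap.range A.dHom := by
        have h := ds.d_eq i (i + 2) (by omega) (by omega)
          (by intro h; rw [Prod.mk.injEq] at h; omega)
        have hs : Finset.Ioo i (i + 2) = {i + 1} := by
          ext; rw [Finset.mem_Ioo, Finset.mem_singleton]; omega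
        rw [hs, Finset.sum_singleton, ← A.mulHom_apply, map_smul, LinearMap.smul_apply] at h
        rw [← Submodule.smul_mem_iff _ (zpow_ne_zero (mDeg dg i (i + 1))
          (show (-1 : K) ≠ 0 by norm_num)), ← h, ← A.dHom_apply]
        exact LinearMap.mem_range_self _ _
      have hf := A.mul_exact_of_cohomologous (hf1 i)
        (hmem _ hi) hc he
        (AInftyHomData.d_f1_of_d_eq_zero hB hφ (hx i)) (hcoc _ hi) hc' he' hprod
      obtain ⟨b, hb⟩ := hf
      obtain ⟨w, hw⟩ := AInftyHomData.map_mul_of_d_eq_zero hB hφ (fun l => dg (i + l))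
        (fun l => x (i + l)) (fun l => hx _)
      obtain ⟨z, hz⟩ := hq.1 (B.mul (x i) (x (i + 1))) (hB _) ⟨w + b, by
        change _ = A.d _
        rw [← A.dHom_apply, map_add, hb]
        exact hw⟩
      rw [hz]
      exact hB z
    · rw [hx0 (i + 1) (by omega), ← B.mulHom_apply, map_zero]
  let ds' : DefiningSystem A n dg u :=
    { a := φ.masseyCochain dg x
      mem_grading := fun i j hij _ _ => φ.masseyCochain_mem hx hij
      represents := by
        intro i hi
        obtain ⟨c, -, hc⟩ := hxc i hi
        obtain ⟨b, hb⟩ := ds.represents i hi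
        refine ⟨b - c, ?_⟩
        have h1 : φ.masseyCochain dg x i (i + 1) = φ.f1 (x i) := by
          rw [AInftyHomData.masseyCochain, masseySign_succ, Nat.add_sub_cancel_left,
            AInftyHomData.eval_one]
          norm_num
        rw [← A.dHom_apply, map_sub, ← hc, A.dHom_apply, ← hb, h1]
        abel
      d_eq := fun i j hij _ _ => AInftyHomData.d_masseyCochain hB hφ hx hmul hij }
  refine ⟨ds', φ.masseyCochain dg x 0 n, ?_⟩
  rw [sub_zero]
  exact (AInftyHomData.d_masseyCochain hB hφ hx hmul (by omega)).symm
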